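/- Let G be a natural unit interval graph on {1,…,n} and for 2 ≤ k ≤ n let b_k denote the number of neighbours i of vertex k with i < k. Then the coefficient of e_n in the chromatic quasisymmetric function X_G(x;q) is c_n(q) = [n]_q [b_2]_q [b_3]_q ⋯ [b_n]_q. -/

import Mathlib

open Finset MvPolynomial
open scoped Classical

noncomputable section

/-- `κ` is a proper colouring of `G`. -/
def IsProper {n N : ℕ} (G : SimpleGraph (Fin n)) (κ : Fin n → Fin N) : Prop :=
  ∀ i j, G.Adj i j → κ i ≠ κ j

/-- The chromatic symmetric function of `G`, truncated to `N` variables. -/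
def chromSym (n N : ℕ) (G : SimpleGraph (Fin n)) : MvPolynomial (Fin N) ℤ :=
  ∑ κ : Fin n → Fin N, if IsProper G κ then ∏ i, X (κ i) else 0

/-- The number of ascents of a colouring. -/
def ascNum {n N : ℕ} (G : SimpleGraph (Fin n)) (κ : Fin n → Fin N) : ℕ :=
  ((Finset.univ : Finset (Fin n × Fin n)).filter fun p =>
    G.Adj p.1 p.2 ∧ p.1 < p.2 ∧ κ p.1 < κ p.2).card

/-- The chromatic quasisymmetric function of `G`, with coefficients in `ℤ[q]`,
truncated to `N` variables. -/
def chromQSym (n N : ℕ) (G : SimpleGraph (Fin n)) :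
    MvPolynomial (Fin N) (Polynomial ℤ) :=
  ∑ κ : Fin n → Fin N, if IsProper G κ then
    C (Polynomial.X ^ ascNum G κ) * ∏ i, X (κ i) else 0

/-- `e_λ`, the product of elementary symmetric polynomials over the parts of `λ`. -/
def eProd (N : ℕ) (R : Type) [CommSemiring R] {n : ℕ} (p : Nat.Partition n) :
    MvPolynomial (Fin N) R :=
  (p.parts.map fun k => esymm (Fin N) R k).prod

/-- The number of parts of a partition, i.e. `λ'_1`. -/
def numParts {n : ℕ} (p : Nat.Partition n) : ℕ := Multiset.card p.parts

/-- The largest part `λ_1` of a partition. -/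
def maxPart {n : ℕ} (p : Nat.Partition n) : ℕ := p.parts.sup

/-- `λ'_1 + ⋯ + λ'_k`, the number of cells in the first `k` columns of `λ`. -/
def conjSum {n : ℕ} (p : Nat.Partition n) (k : ℕ) : ℕ :=
  (p.parts.map fun a => min a k).sum

/-- `λ_1 + ⋯ + λ_k`, the number of cells in the first `k` rows of `λ`. -/
def partSum {n : ℕ} (p : Nat.Partition n) (k : ℕ) : ℕ :=
  ∑ j ∈ Finset.Icc 1 n, min (Multiset.card (p.parts.filter fun a => j ≤ a)) k

/-- `s` is an independent set of vertices of `G`. -/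
def IsIndepFinset {V : Type} (G : SimpleGraph V) (s : Finset V) : Prop :=
  ∀ i ∈ s, ∀ j ∈ s, ¬ G.Adj i j

/-- `s` is a clique of `G`. -/
def IsCliqueFinset {V : Type} (G : SimpleGraph V) (s : Finset V) : Prop :=
  ∀ i ∈ s, ∀ j ∈ s, i ≠ j → G.Adj i j

/-- The independence number `α(G)`. -/
def indepNum {n : ℕ} (G : SimpleGraph (Fin n)) : ℕ :=
  sSup {k | ∃ s : Finset (Fin n), IsIndepFinset G s ∧ s.card = k}

/-- The clique number `ω(G)`. -/
def cliqueNum {n : ℕ} (G : SimpleGraph (Fin n)) : ℕ :=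
  sSup {k | ∃ s : Finset (Fin n), IsCliqueFinset G s ∧ s.card = k}

/-- `α_k(G)`: the maximum number of vertices in an independent partition
with `k` blocks. -/
def alphaK {n : ℕ} (G : SimpleGraph (Fin n)) (k : ℕ) : ℕ :=
  sSup {m | ∃ B : Fin k → Finset (Fin n),
    (∀ i j, i ≠ j → Disjoint (B i) (B j)) ∧
    (∀ i, IsIndepFinset G (B i)) ∧ m = ∑ i, (B i).card}

/-- `ω_k(G)`: the maximum number of vertices in a clique partition
with `k` blocks. -/
def omegaK {n : ℕ} (G : SimpleGraph (Fin n)) (k : ℕ) : ℕ :=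
  sSup {m | ∃ B : Fin k → Finset (Fin n),
    (∀ i j, i ≠ j → Disjoint (B i) (B j)) ∧
    (∀ i, IsCliqueFinset G (B i)) ∧ m = ∑ i, (B i).card}

/-- `G` is a natural unit interval graph. -/
def IsNUIG {n : ℕ} (G : SimpleGraph (Fin n)) : Prop :=
  ∀ i j k : Fin n, i < j → j < k → G.Adj i k → G.Adj i j ∧ G.Adj j k

/-- The `q`-integer `[k]_q = 1 + q + ⋯ + q^(k-1)` in `ℤ[q]`. -/
def qInt (k : ℕ) : Polynomial ℤ := ∑ i ∈ Finset.range k, Polynomial.X ^ i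

/-- The `q`-factorial `[k]_q!` in `ℤ[q]`. -/
def qFact : ℕ → Polynomial ℤ
  | 0 => 1
  | k + 1 => qInt (k + 1) * qFact k

end

/-- `b_k`: the number of neighbours of `k` smaller than `k`. -/
noncomputable def smallerNbrs {n : ℕ} (G : SimpleGraph (Fin n)) (k : Fin n) : ℕ :=
  (Finset.univ.filter fun i : Fin n => i < k ∧ G.Adj i k).card

/-! ### Polynomial interpolation of binomials -/

theorem exists_binPoly (k : ℕ) : ∃ P : Polynomial ℚ, P.degree ≤ k ∧
    (∀ M : ℕ, P.eval (M : ℚ) = (M.choose k : ℚ)) ∧ P.eval (-1) = (-1) ^ k := by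
  induction k with
  | zero => exact ⟨1, by simp, by simp, by simp⟩
  | succ k ih =>
    obtain ⟨P, h1, h2, h3⟩ := ih
    refine ⟨P * (Polynomial.C (1 / ((k : ℚ) + 1)) * (Polynomial.X - Polynomial.C (k : ℚ))), ?_, ?_, ?_⟩
    · refine (Polynomial.degree_mul_le _ _).trans ?_
      push_cast
      refine add_le_add h1 ?_
      rw [Polynomial.degree_C_mul (by positivity), Polynomial.degree_X_sub_C]
    · intro M
      have hk : (k : ℚ) + 1 ≠ 0 := by positivity
      simp only [Polynomial.eval_mul, Polynomial.eval_C, Polynomial.eval_sub, Polynomial.eval_X, h2]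
      rcases lt_or_ge M k with h | h
      · simp [Nat.choose_eq_zero_of_lt h, Nat.choose_eq_zero_of_lt (show M < k + 1 by omega)]
      · have := Nat.choose_succ_right_eq M k
        have h' : (M.choose (k+1) : ℚ) * (k + 1) = M.choose k * (M - k) := by
          rw [← Nat.cast_sub h]; exact_mod_cast this
        field_simp
        linarith
    · have hk : (k : ℚ) + 1 ≠ 0 := by positivity
      simp only [Polynomial.eval_mul, Polynomial.eval_C, Polynomial.eval_sub, Polynomial.eval_X, h3]
      field_simp
      ring

theorem sum_eval_neg_one {n : ℕ} (P : Polynomial ℚ) (hP : P.degree < n) :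
    ∑ M ∈ range n, (-1 : ℚ) ^ M * (n.choose (M + 1) : ℚ) * P.eval (M : ℚ) = P.eval (-1) := by
  rcases eq_or_ne P 0 with rfl | h0
  · simp
  have hd : P.natDegree < n := (Polynomial.natDegree_lt_iff_degree_lt h0).2 hP
  have h := congrFun (Polynomial.fwdDiff_iter_eq_zero_of_degree_lt hd) (-1)
  rw [fwdDiff_iter_eq_sum_shift, Finset.sum_range_succ'] at h
  simp only [Pi.zero_apply] at h
  have hs : ∀ M ∈ range n, ((-1 : ℤ) ^ (n - (M + 1)) * (n.choose (M + 1) : ℤ)) •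
      P.eval (-1 + (M + 1) • (1 : ℚ)) = (-1) ^ n * (-1) *
        ((-1 : ℚ) ^ M * (n.choose (M + 1) : ℚ) * P.eval (M : ℚ)) := by
    intro M hM
    have hM' : M < n := by simpa using hM
    obtain ⟨d, rfl⟩ : ∃ d, n = d + (M + 1) := ⟨n - (M + 1), by omega⟩
    have e : (-1 + (M + 1) • (1 : ℚ)) = M := by simp
    have e2 : (-1 : ℚ) ^ (d + (M + 1)) * (-1) * (-1) ^ M = (-1) ^ d := by
      rw [pow_add, pow_succ]
      have : ((-1 : ℚ) ^ M) * (-1) ^ M = 1 := by rw [← mul_pow]; simp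
      linear_combination (-1 : ℚ) ^ d * this
    rw [e, zsmul_eq_mul, Nat.add_sub_cancel]
    push_cast
    rw [← e2]; ring
  rw [Finset.sum_congr rfl hs, ← Finset.mul_sum] at h
  have hn : ((-1 : ℚ) ^ n) * (-1) ^ n = 1 := by rw [← mul_pow]; simp
  simp at h
  linear_combination (-(-1 : ℚ) ^ n) * h + (P.eval (-1) - ∑ M ∈ range n, (-1 : ℚ) ^ M * (n.choose (M + 1) : ℚ) * P.eval (M : ℚ)) * hn

/-! ### Evaluation in the dual numbers -/

/-- First variable `1 + ε`, the next `M` variables `1`, all others `0`. -/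
noncomputable def evp (N M : ℕ) : Fin N → DualNumber (Polynomial ℤ) := fun i =>
  if (i : ℕ) = 0 then 1 + DualNumber.eps else if (i : ℕ) ≤ M then 1 else 0

theorem aeval_esymm_evp (N M k : ℕ) (h : M + 1 ≤ N) :
    aeval (evp N M) (esymm (Fin N) (Polynomial ℤ) (k + 1)) =
      ((M + 1).choose (k + 1) : DualNumber (Polynomial ℤ)) +
        (M.choose k : DualNumber (Polynomial ℤ)) * DualNumber.eps := by
  obtain ⟨N, rfl⟩ : ∃ N', N = N' + 1 := ⟨N - 1, by omega⟩
  set S' : Finset (Fin (N + 1)) := univ.filter (fun i => 1 ≤ (i : ℕ) ∧ (i : ℕ) ≤ M) with hS'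
  have h0 : (0 : Fin (N + 1)) ∉ S' := by simp [hS']
  have hcard : S'.card = M := by
    have : S'.map Fin.valEmbedding = Finset.Icc 1 M := by
      ext a
      simp only [hS', Finset.mem_map, Finset.mem_filter, Finset.mem_univ, true_and,
        Fin.valEmbedding_apply, Finset.mem_Icc]
      constructor
      · rintro ⟨i, hi, rfl⟩; exact hi
      · intro ha; exact ⟨⟨a, by omega⟩, ha, rfl⟩
    rw [← Finset.card_map Fin.valEmbedding, this]; simp
  have hsub : ∑ t ∈ powersetCard (k + 1) (univ : Finset (Fin (N + 1))), ∏ i ∈ t, evp (N + 1) M i =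
      ∑ t ∈ powersetCard (k + 1) (insert 0 S'), ∏ i ∈ t, evp (N + 1) M i := by
    symm
    apply Finset.sum_subset (powersetCard_mono (subset_univ _))
    intro t ht ht'
    simp only [mem_powersetCard, subset_univ, true_and] at ht ht'
    have : ¬ t ⊆ insert 0 S' := fun hh => ht' ⟨hh, ht⟩
    obtain ⟨i, hi, hi'⟩ := Finset.not_subset.1 this
    apply Finset.prod_eq_zero hi
    simp only [hS', Finset.mem_insert, Finset.mem_filter, Finset.mem_univ, true_and, not_or] at hi'
    have hi0 : (i : ℕ) ≠ 0 := fun hh => hi'.1 (Fin.ext hh)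
    simp only [evp, hi0, if_false]
    rw [if_neg]; omega
  have hone : ∀ t ⊆ S', ∏ i ∈ t, evp (N + 1) M i = 1 := by
    intro t ht
    apply Finset.prod_eq_one
    intro i hi
    have := ht hi
    simp only [hS', Finset.mem_filter, Finset.mem_univ, true_and] at this
    simp only [evp]
    rw [if_neg (by omega), if_pos this.2]
  have hcase : aeval (evp (N + 1) M) (esymm (Fin (N + 1)) (Polynomial ℤ) (k + 1)) =
    ∑ t ∈ powersetCard (k + 1) (univ : Finset (Fin (N + 1))), ∏ i ∈ t, evp (N + 1) M i := by
    simp [esymm]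
  rw [hcase, hsub, powersetCard_succ_insert h0, Finset.sum_union, Finset.sum_image]
  · have h1 : ∑ t ∈ powersetCard (k + 1) S', ∏ i ∈ t, evp (N + 1) M i =
        (M.choose (k + 1) : DualNumber (Polynomial ℤ)) := by
      rw [Finset.sum_congr rfl (fun t ht => hone t (mem_powersetCard.1 ht).1)]
      simp [hcard]
    have h2 : ∑ t ∈ powersetCard k S', ∏ i ∈ insert 0 t, evp (N + 1) M i =
        (M.choose k : DualNumber (Polynomial ℤ)) * (1 + DualNumber.eps) := by
      rw [Finset.sum_congr rfl (g := fun _ => (1 + DualNumber.eps : DualNumber (Polynomial ℤ)))]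
      · simp [hcard, mul_add]
      · intro t ht
        have ht' := (mem_powersetCard.1 ht).1
        rw [Finset.prod_insert (fun hh => h0 (ht' hh)), hone t ht']
        simp [evp]
    rw [h1, h2, Nat.choose_succ_succ]
    push_cast
    ring
  · intro a ha b hb hab
    have ha' := (mem_powersetCard.1 ha).1
    have hb' := (mem_powersetCard.1 hb).1
    have := congrArg (fun s => Finset.erase s 0) hab
    simpa [Finset.erase_insert (fun hh => h0 (ha' hh)),
      Finset.erase_insert (fun hh => h0 (hb' hh))] using this
  · rw [Finset.disjoint_left]
    intro t ht ht'
    obtain ⟨u, hu, rfl⟩ := Finset.mem_image.1 ht'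
    exact h0 ((mem_powersetCard.1 ht).1 (mem_insert_self _ _))

theorem exists_poly_prod (s : Multiset ℕ) (hs : ∀ k ∈ s, 0 < k) :
    ∃ (E D : Polynomial ℚ) (d0 d1 : ℕ → ℤ), E.degree ≤ (s.sum : ℕ) ∧ D.degree < (s.sum : ℕ) ∧
      (∀ M : ℕ, E.eval (M : ℚ) = d0 M) ∧ (∀ M : ℕ, D.eval (M : ℚ) = d1 M) ∧
      (∀ N M : ℕ, M + 1 ≤ N →
        aeval (evp N M) (s.map fun k => esymm (Fin N) (Polynomial ℤ) k).prod =
          (d0 M : DualNumber (Polynomial ℤ)) + (d1 M : DualNumber (Polynomial ℤ)) * DualNumber.eps) ∧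
      (E.eval (-1) = if s = 0 then 1 else 0) ∧
      (D.eval (-1) = if Multiset.card s = 1 then (-1) ^ (s.sum - 1) else 0) := by
  induction s using Multiset.induction with
  | empty =>
    refine ⟨1, 0, fun _ => 1, fun _ => 0, ?_, ?_, ?_, ?_, ?_, ?_, ?_⟩ <;> simp
  | cons k s ih =>
    obtain ⟨E, D, d0, d1, hE, hD, hE', hD', hev, hE1, hD1⟩ :=
      ih (fun j hj => hs j (Multiset.mem_cons_of_mem hj))
    obtain ⟨k, rfl⟩ : ∃ k', k = k' + 1 :=
      ⟨k - 1, by have := hs k (Multiset.mem_cons_self _ _); omega⟩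
    obtain ⟨P, hP, hP', hP1⟩ := exists_binPoly (k + 1)
    obtain ⟨Q, hQ, hQ', hQ1⟩ := exists_binPoly k
    have hPc : (P.comp (Polynomial.X + Polynomial.C 1)).degree ≤ (k + 1 : ℕ) := by
      rw [← Polynomial.natDegree_le_iff_degree_le] at hP ⊢
      rw [Polynomial.natDegree_comp]
      rw [Polynomial.natDegree_X_add_C, mul_one]
      exact hP
    refine ⟨P.comp (Polynomial.X + Polynomial.C 1) * E,
      P.comp (Polynomial.X + Polynomial.C 1) * D + Q * E,
      fun M => ((M + 1).choose (k + 1) : ℤ) * d0 M,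
      fun M => ((M + 1).choose (k + 1) : ℤ) * d1 M + (M.choose k : ℤ) * d0 M,
      ?_, ?_, ?_, ?_, ?_, ?_, ?_⟩
    · refine (Polynomial.degree_mul_le _ _).trans ?_
      rw [Multiset.sum_cons]
      rw [Nat.cast_add]
      exact add_le_add hPc hE
    · rw [Multiset.sum_cons]
      refine (Polynomial.degree_add_le _ _).trans_lt (max_lt ?_ ?_)
      · by_cases hD0 : D = 0
        · rw [hD0, mul_zero, Polynomial.degree_zero]; exact WithBot.bot_lt_coe _
        · rw [← Polynomial.natDegree_lt_iff_degree_lt hD0] at hD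
          rw [← Polynomial.natDegree_le_iff_degree_le] at hPc
          refine (Polynomial.degree_le_natDegree).trans_lt ?_
          have := Polynomial.natDegree_mul_le (p := P.comp (Polynomial.X + Polynomial.C 1)) (q := D)
          exact_mod_cast (by omega)
      · rw [← Polynomial.natDegree_le_iff_degree_le] at hQ hE
        refine (Polynomial.degree_le_natDegree).trans_lt ?_
        have := Polynomial.natDegree_mul_le (p := Q) (q := E)
        exact_mod_cast (by omega)
    · intro M
      have := hP' (M + 1)
      push_cast at this
      simp [hE', this]
    · intro M
      have := hP' (M + 1)
      push_cast at this
      simp [hE', hD', hQ', this]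
    · intro N M h
      rw [Multiset.map_cons, Multiset.prod_cons, map_mul, hev N M h, aeval_esymm_evp N M k h]
      have he : (DualNumber.eps : DualNumber (Polynomial ℤ)) * DualNumber.eps = 0 :=
        DualNumber.eps_mul_eps
      push_cast
      linear_combination (M.choose k : DualNumber (Polynomial ℤ)) * d1 M * he
    · have := hP' 0
      simp at this
      simp [this]
    · have := hP' 0
      simp at this
      simp [this, hQ1, hE1]
      by_cases h0 : s = 0 <;> simp [h0]

/-! ### Surjective colourings and insertion of the last vertex -/

/-- Weight of a colouring. -/
noncomputable def wt {n ℓ : ℕ} (G : SimpleGraph (Fin n)) (κ : Fin n → Fin ℓ) : Polynomial ℤ :=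
  if IsProper G κ then Polynomial.X ^ ascNum G κ else 0

/-- Non-dependent `Fin.snoc`. -/
def sn {n ℓ : ℕ} (σ : Fin n → Fin ℓ) (i : Fin ℓ) : Fin (n + 1) → Fin ℓ :=
  Fin.snoc (α := fun _ => Fin ℓ) σ i

@[simp] theorem sn_castSucc {n ℓ : ℕ} (σ : Fin n → Fin ℓ) (i : Fin ℓ) (u : Fin n) :
    sn σ i u.castSucc = σ u := by simp [sn]

@[simp] theorem sn_last {n ℓ : ℕ} (σ : Fin n → Fin ℓ) (i : Fin ℓ) :
    sn σ i (Fin.last n) = i := by simp [sn]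

theorem sn_surj {n ℓ : ℕ} (σ : Fin n → Fin ℓ) (i : Fin ℓ) :
    Function.Surjective (sn σ i) ↔ ∀ j, j ≠ i → ∃ u, σ u = j := by
  constructor
  · intro h j hj
    obtain ⟨x, hx⟩ := h j
    induction x using Fin.lastCases with
    | last => simp at hx; exact absurd hx.symm hj
    | cast u => exact ⟨u, by simpa using hx⟩
  · intro h j
    by_cases hj : j = i
    · exact ⟨Fin.last n, by simp [hj]⟩
    · obtain ⟨u, hu⟩ := h j hj
      exact ⟨u.castSucc, by simpa using hu⟩

theorem sum_surj_succ {n ℓ : ℕ} (f : (Fin (n + 1) → Fin (ℓ + 1)) → Polynomial ℤ) :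
    (∑ κ : Fin (n + 1) → Fin (ℓ + 1), if Function.Surjective κ then f κ else 0) =
      (∑ σ : Fin n → Fin (ℓ + 1), if Function.Surjective σ then ∑ i, f (sn σ i) else 0) +
      ∑ σ : Fin n → Fin ℓ, if Function.Surjective σ then
        ∑ i : Fin (ℓ + 1), f (sn (i.succAbove ∘ σ) i) else 0 := by
  have h1 : (∑ κ : Fin (n + 1) → Fin (ℓ + 1), if Function.Surjective κ then f κ else 0) =
      ∑ i : Fin (ℓ + 1), ∑ σ : Fin n → Fin (ℓ + 1),
        if Function.Surjective (sn σ i) then f (sn σ i) else 0 := by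
    rw [← Fintype.sum_prod_type']
    exact (Equiv.sum_comp (Fin.snocEquiv (fun _ => Fin (ℓ + 1)))
      (fun κ : Fin (n + 1) → Fin (ℓ + 1) => if Function.Surjective κ then f κ else 0)).symm
  have h2 : ∀ i : Fin (ℓ + 1), (∑ σ : Fin n → Fin (ℓ + 1),
      if Function.Surjective (sn σ i) then f (sn σ i) else 0) =
      (∑ σ : Fin n → Fin (ℓ + 1), if Function.Surjective σ then f (sn σ i) else 0) +
      ∑ σ : Fin n → Fin ℓ, if Function.Surjective σ then f (sn (i.succAbove ∘ σ) i) else 0 := by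
    intro i
    have h3 : ∀ σ : Fin n → Fin (ℓ + 1),
        (if Function.Surjective (sn σ i) then f (sn σ i) else 0) =
        (if Function.Surjective σ then f (sn σ i) else 0) +
        (if Function.Surjective (sn σ i) ∧ ¬ Function.Surjective σ then f (sn σ i) else 0) := by
      intro σ
      by_cases hs : Function.Surjective σ
      · have : Function.Surjective (sn σ i) := (sn_surj σ i).2 (fun j _ => hs j)
        simp [hs, this]
      · simp [hs]
    rw [Finset.sum_congr rfl (fun σ _ => h3 σ), Finset.sum_add_distrib]
    congr 1
    rw [← Finset.sum_filter, ← Finset.sum_filter]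
    symm
    apply Finset.sum_bij (fun (σ : Fin n → Fin ℓ) _ => i.succAbove ∘ σ)
    · intro σ hσ
      simp only [Finset.mem_filter, Finset.mem_univ, true_and] at hσ ⊢
      constructor
      · rw [sn_surj]
        intro j hj
        obtain ⟨k, rfl⟩ := Fin.exists_succAbove_eq hj
        obtain ⟨u, rfl⟩ := hσ k
        exact ⟨u, rfl⟩
      · intro hs
        obtain ⟨u, hu⟩ := hs i
        exact Fin.succAbove_ne _ _ hu
    · intro a _ b _ hab
      funext u
      exact Fin.succAbove_right_injective (congrFun hab u)
    · intro κ hκ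
      simp only [Finset.mem_filter, Finset.mem_univ, true_and] at hκ
      obtain ⟨ha, hb⟩ := hκ
      rw [sn_surj] at ha
      have hne : ∀ u, κ u ≠ i := by
        intro u hu
        apply hb
        intro j
        by_cases hj : j = i
        · exact ⟨u, by rw [hu, hj]⟩
        · exact ha j hj
      choose σ hσ using fun u => Fin.exists_succAbove_eq (hne u)
      refine ⟨σ, ?_, funext hσ⟩
      simp only [Finset.mem_filter, Finset.mem_univ, true_and]
      intro k
      obtain ⟨u, hu⟩ := ha (i.succAbove k) (Fin.succAbove_ne _ _)
      refine ⟨u, ?_⟩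
      rw [← hσ u] at hu
      exact Fin.succAbove_right_injective hu
    · intro σ _
      rfl
  rw [h1, Finset.sum_congr rfl (fun i _ => h2 i), Finset.sum_add_distrib, Finset.sum_comm,
    Finset.sum_comm (s := (univ : Finset (Fin (ℓ + 1)))) (t := (univ : Finset (Fin n → Fin ℓ)))]
  congr 1
  · apply Finset.sum_congr rfl
    intro σ _
    split_ifs <;> simp
  · apply Finset.sum_congr rfl
    intro σ _
    split_ifs <;> simp

theorem insertion {n : ℕ} (f : ∀ ℓ, (Fin (n + 1) → Fin ℓ) → Polynomial ℤ) :
    (∑ ℓ ∈ range (n + 2), (-1) ^ ℓ *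
      ∑ κ : Fin (n + 1) → Fin ℓ, if Function.Surjective κ then f ℓ κ else 0) =
    ∑ ℓ ∈ range (n + 1), (-1) ^ ℓ * ∑ σ : Fin n → Fin ℓ, if Function.Surjective σ then
      ((∑ i : Fin ℓ, f ℓ (sn σ i)) - ∑ i : Fin (ℓ + 1), f (ℓ + 1) (sn (i.succAbove ∘ σ) i))
      else 0 := by
  set a : ℕ → Polynomial ℤ := fun ℓ => ∑ σ : Fin n → Fin ℓ,
    if Function.Surjective σ then ∑ i : Fin ℓ, f ℓ (sn σ i) else 0 with ha
  set b : ℕ → Polynomial ℤ := fun ℓ => ∑ σ : Fin n → Fin ℓ, if Function.Surjective σ then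
    ∑ i : Fin (ℓ + 1), f (ℓ + 1) (sn (i.succAbove ∘ σ) i) else 0 with hb
  have hR : ∀ ℓ, (∑ σ : Fin n → Fin ℓ, if Function.Surjective σ then
      ((∑ i : Fin ℓ, f ℓ (sn σ i)) - ∑ i : Fin (ℓ + 1), f (ℓ + 1) (sn (i.succAbove ∘ σ) i))
      else 0) = a ℓ - b ℓ := by
    intro ℓ
    rw [ha, hb]
    simp only
    rw [← Finset.sum_sub_distrib]
    apply Finset.sum_congr rfl
    intro σ _
    split_ifs <;> simp
  simp only [hR]
  rw [Finset.sum_range_succ']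
  have h0 : ∑ κ : Fin (n + 1) → Fin 0, (if Function.Surjective κ then f 0 κ else 0) = 0 := by
    apply Finset.sum_eq_zero
    intro κ _
    exact (κ 0).elim0
  have ha0 : a 0 = 0 := by
    rw [ha]
    simp
  have han : a (n + 1) = 0 := by
    rw [ha]
    apply Finset.sum_eq_zero
    intro σ _
    rw [if_neg]
    intro hs
    have := Fintype.card_le_of_surjective σ hs
    simp at this
  rw [h0, mul_zero, add_zero]
  simp only [sum_surj_succ]
  have : ∀ ℓ ∈ range (n + 1), (-1 : Polynomial ℤ) ^ (ℓ + 1) * (a (ℓ + 1) + b ℓ) =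
      (-1) ^ ℓ * (a ℓ - b ℓ) + ((-1) ^ (ℓ + 1) * a (ℓ + 1) - (-1) ^ ℓ * a ℓ) := by
    intro ℓ _; ring
  rw [Finset.sum_congr rfl this, Finset.sum_add_distrib,
    Finset.sum_range_sub (fun ℓ => (-1 : Polynomial ℤ) ^ ℓ * a ℓ), ha0, han]
  simp

theorem isProper_sn {n ℓ : ℕ} (G : SimpleGraph (Fin (n + 1))) (σ : Fin n → Fin ℓ) (i : Fin ℓ) :
    IsProper G (sn σ i) ↔ IsProper (G.comap Fin.castSucc) σ ∧
      ∀ u : Fin n, G.Adj u.castSucc (Fin.last n) → σ u ≠ i := by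
  constructor
  · intro h
    refine ⟨fun a b hab => ?_, fun u hu => ?_⟩
    · simpa using h a.castSucc b.castSucc hab
    · simpa using h u.castSucc (Fin.last n) hu
  · rintro ⟨h1, h2⟩ a b hab
    induction a using Fin.lastCases with
    | last =>
      induction b using Fin.lastCases with
      | last => exact absurd hab (G.loopless.irrefl _)
      | cast b => simpa using (h2 b hab.symm).symm
    | cast a =>
      induction b using Fin.lastCases with
      | last => simpa using h2 a hab
      | cast b => simpa using h1 a b hab

theorem ascNum_sn {n ℓ : ℕ} (G : SimpleGraph (Fin (n + 1))) (σ : Fin n → Fin ℓ) (i : Fin ℓ) :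
    ascNum G (sn σ i) = ascNum (G.comap Fin.castSucc) σ +
      (univ.filter fun u : Fin n => G.Adj u.castSucc (Fin.last n) ∧ σ u < i).card := by
  simp only [ascNum, Finset.card_filter, Fintype.sum_prod_type, Fin.sum_univ_castSucc]
  have hl : ∀ x : Fin n, ¬ (Fin.last n < x.castSucc) := fun x => not_lt.2 (Fin.le_last _)
  simp [hl, Finset.sum_add_distrib, Fin.castSucc_lt_last]

theorem isProper_comp {n ℓ m : ℕ} (G : SimpleGraph (Fin n)) (σ : Fin n → Fin ℓ)
    (ι : Fin ℓ → Fin m) (hι : StrictMono ι) : IsProper G (ι ∘ σ) ↔ IsProper G σ := by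
  simp [IsProper, hι.injective.eq_iff]

theorem ascNum_comp {n ℓ m : ℕ} (G : SimpleGraph (Fin n)) (σ : Fin n → Fin ℓ)
    (ι : Fin ℓ → Fin m) (hι : StrictMono ι) : ascNum G (ι ∘ σ) = ascNum G σ := by
  simp [ascNum, hι.lt_iff_lt]

theorem wt_comp {n ℓ m : ℕ} (G : SimpleGraph (Fin n)) (σ : Fin n → Fin ℓ)
    (ι : Fin ℓ → Fin m) (hι : StrictMono ι) : wt G (ι ∘ σ) = wt G σ := by
  simp [wt, isProper_comp G σ ι hι, ascNum_comp G σ ι hι]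

/-- number of smaller neighbours of the last vertex with colour `< j` -/
noncomputable def gcount {n ℓ : ℕ} (G : SimpleGraph (Fin (n + 1))) (σ : Fin n → Fin ℓ) (j : ℕ) : ℕ :=
  (univ.filter fun u : Fin n => G.Adj u.castSucc (Fin.last n) ∧ (σ u : ℕ) < j).card

theorem wt_sn {n ℓ : ℕ} (G : SimpleGraph (Fin (n + 1))) (σ : Fin n → Fin ℓ) (i : Fin ℓ) :
    wt G (sn σ i) = wt (G.comap Fin.castSucc) σ *
      (if ∃ u : Fin n, G.Adj u.castSucc (Fin.last n) ∧ (σ u : ℕ) = i then 0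
        else Polynomial.X ^ gcount G σ i) := by
  have e : (∃ u : Fin n, G.Adj u.castSucc (Fin.last n) ∧ (σ u : ℕ) = i) ↔
      ¬ ∀ u : Fin n, G.Adj u.castSucc (Fin.last n) → σ u ≠ i := by
    push Not
    simp [Fin.ext_iff]
  simp only [wt, isProper_sn, ascNum_sn, e]
  by_cases h1 : IsProper (G.comap Fin.castSucc) σ
  · by_cases h2 : ∀ u : Fin n, G.Adj u.castSucc (Fin.last n) → σ u ≠ i
    · rw [if_pos ⟨h1, h2⟩, if_pos h1, if_neg (not_not.2 h2), pow_add]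
      rfl
    · rw [if_neg (fun h => h2 h.2), if_pos h2, mul_zero]
  · rw [if_neg (fun h => h1 h.1), if_neg h1, zero_mul]

theorem wt_sn_succAbove {n ℓ : ℕ} (G : SimpleGraph (Fin (n + 1))) (σ : Fin n → Fin ℓ)
    (i : Fin (ℓ + 1)) :
    wt G (sn (i.succAbove ∘ σ) i) = wt (G.comap Fin.castSucc) σ *
      Polynomial.X ^ gcount G σ i := by
  rw [wt_sn, wt_comp _ _ _ (Fin.strictMono_succAbove i), if_neg]
  · congr 2
    simp only [gcount]
    congr 1
    ext u
    simp only [Finset.mem_filter, Finset.mem_univ, true_and, Function.comp]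
    have : i.succAbove (σ u) < i ↔ (σ u).castSucc < i := Fin.succAbove_lt_iff_castSucc_lt _ _
    rw [Fin.lt_def, Fin.lt_def] at this
    rw [this]
    simp
  · rintro ⟨u, _, hu⟩
    exact Fin.succAbove_ne _ _ (Fin.ext hu)

theorem qInt_succ' (k : ℕ) : qInt (k + 1) = qInt k + Polynomial.X ^ k := by
  simp [qInt, Finset.sum_range_succ]

theorem qsum (t : ℕ → Prop) [DecidablePred t] (g : ℕ → ℕ) (h0 : g 0 = 0)
    (hs : ∀ j, g (j + 1) = g j + if t j then 1 else 0) (L : ℕ) :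
    (∑ j ∈ range L, (if t j then 0 else Polynomial.X ^ g j)) -
      ∑ j ∈ range L, (Polynomial.X : Polynomial ℤ) ^ g (j + 1) =
      - (Polynomial.X * qInt (g L)) := by
  induction L with
  | zero => simp [h0, qInt]
  | succ L ih =>
    rw [Finset.sum_range_succ, Finset.sum_range_succ, hs L]
    by_cases h : t L
    · simp only [h, if_true, qInt_succ']
      linear_combination ih
    · simp only [h, if_false, add_zero]
      linear_combination ih

theorem gcount_succ {n ℓ : ℕ} (G : SimpleGraph (Fin (n + 1))) (hG : IsNUIG G) (σ : Fin n → Fin ℓ)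
    (hσ : IsProper (G.comap Fin.castSucc) σ) (j : ℕ) :
    gcount G σ (j + 1) = gcount G σ j +
      if ∃ u : Fin n, G.Adj u.castSucc (Fin.last n) ∧ (σ u : ℕ) = j then 1 else 0 := by
  have hun : ∀ u u' : Fin n, G.Adj u.castSucc (Fin.last n) → G.Adj u'.castSucc (Fin.last n) →
      σ u = σ u' → u = u' := by
    intro u u' hu hu' he
    by_contra hne
    rcases lt_or_gt_of_ne hne with h | h
    · exact hσ u u' (hG u.castSucc u'.castSucc (Fin.last n) h (Fin.castSucc_lt_last _) hu).1 he
    · exact hσ u' u (hG u'.castSucc u.castSucc (Fin.last n) h (Fin.castSucc_lt_last _) hu').1 he.symm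
  have hsplit : gcount G σ (j + 1) = gcount G σ j +
      (univ.filter fun u : Fin n => G.Adj u.castSucc (Fin.last n) ∧ (σ u : ℕ) = j).card := by
    simp only [gcount]
    rw [← Finset.card_union_of_disjoint]
    · congr 1
      ext u
      simp only [Finset.mem_filter, Finset.mem_univ, true_and, Finset.mem_union]
      rw [Nat.lt_succ_iff_lt_or_eq]
      tauto
    · rw [Finset.disjoint_left]
      intro u hu hu'
      simp only [Finset.mem_filter, Finset.mem_univ, true_and] at hu hu'
      omega
  rw [hsplit]
  congr 1
  split_ifs with h
  · obtain ⟨u, hu, hj⟩ := h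
    rw [Finset.card_eq_one]
    refine ⟨u, ?_⟩
    ext u'
    simp only [Finset.mem_filter, Finset.mem_univ, true_and, Finset.mem_singleton]
    constructor
    · rintro ⟨h1, h2⟩
      exact hun u' u h1 hu (Fin.ext (h2.trans hj.symm))
    · rintro rfl
      exact ⟨hu, hj⟩
  · rw [Finset.card_eq_zero]
    ext u
    simp only [Finset.mem_filter, Finset.mem_univ, true_and, Finset.notMem_empty, iff_false]
    exact fun hh => h ⟨u, hh⟩

/-- Signed sum over surjective colourings in which `v` has the smallest colour. -/
noncomputable def EE {n : ℕ} (G : SimpleGraph (Fin n)) (v : Fin n) : Polynomial ℤ :=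
  ∑ ℓ ∈ range (n + 1), (-1) ^ ℓ * ∑ κ : Fin n → Fin ℓ,
    if Function.Surjective κ then (if (κ v : ℕ) = 0 then wt G κ else 0) else 0

theorem smallerNbrs_last {n : ℕ} (G : SimpleGraph (Fin (n + 1))) :
    smallerNbrs G (Fin.last n) =
      (univ.filter fun u : Fin n => G.Adj u.castSucc (Fin.last n)).card := by
  simp only [smallerNbrs, Finset.card_filter, Fin.sum_univ_castSucc]
  simp [Fin.castSucc_lt_last]

theorem smallerNbrs_castSucc {n : ℕ} (G : SimpleGraph (Fin (n + 1))) (k : Fin n) :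
    smallerNbrs G k.castSucc = smallerNbrs (G.comap Fin.castSucc) k := by
  have hl : ¬ (Fin.last n < k.castSucc) := not_lt.2 (Fin.le_last _)
  simp only [smallerNbrs, Finset.card_filter, Fin.sum_univ_castSucc]
  simp [hl]

theorem gcount_top {n ℓ : ℕ} (G : SimpleGraph (Fin (n + 1))) (σ : Fin n → Fin ℓ) :
    gcount G σ ℓ = smallerNbrs G (Fin.last n) := by
  simp [gcount, smallerNbrs_last]

theorem gcount_zero {n ℓ : ℕ} (G : SimpleGraph (Fin (n + 1))) (σ : Fin n → Fin ℓ) :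
    gcount G σ 0 = 0 := by
  simp [gcount]

theorem EE_castSucc {n : ℕ} (G : SimpleGraph (Fin (n + 1))) (hG : IsNUIG G) (w : Fin n) :
    EE G w.castSucc = - (Polynomial.X * qInt (smallerNbrs G (Fin.last n))) *
      EE (G.comap Fin.castSucc) w := by
  rw [EE, insertion (fun ℓ κ => if (κ w.castSucc : ℕ) = 0 then wt G κ else 0), EE, Finset.mul_sum]
  apply Finset.sum_congr rfl
  intro ℓ _
  rw [mul_left_comm]
  congr 1
  rw [Finset.mul_sum]
  apply Finset.sum_congr rfl
  intro σ _
  by_cases hs : Function.Surjective σ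
  swap
  · simp [hs]
  simp only [hs, if_true, sn_castSucc, Function.comp, Fin.sum_univ_succ (n := ℓ)]
  have hA : ∀ i : Fin ℓ, ((i.succ.succAbove (σ w) : Fin (ℓ + 1)) : ℕ) = 0 ↔ (σ w : ℕ) = 0 := by
    intro i
    simp only [Fin.succAbove, Fin.lt_def, Fin.val_castSucc, Fin.val_succ]
    split_ifs with h
    · simp
    · simp only [Fin.val_succ]; omega
  have h0 : ¬ (((0 : Fin (ℓ + 1)).succAbove (σ w) : Fin (ℓ + 1)) : ℕ) = 0 := by
    simp
  rw [if_neg h0, zero_add]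
  simp only [hA]
  by_cases hw : (σ w : ℕ) = 0
  swap
  · simp [hw]
  simp only [hw, if_true]
  have e1 : ∀ i : Fin ℓ, wt G (sn (i.succ.succAbove ∘ σ) i.succ) =
      wt (G.comap Fin.castSucc) σ * Polynomial.X ^ gcount G σ (i + 1) := by
    intro i
    have := wt_sn_succAbove G σ i.succ
    simpa using this
  simp only [e1]
  simp only [wt_sn, ← Finset.mul_sum]
  rw [← mul_sub]
  by_cases hp : IsProper (G.comap Fin.castSucc) σ
  swap
  · simp [wt, hp]
  have := qsum (fun j => ∃ u : Fin n, G.Adj u.castSucc (Fin.last n) ∧ (σ u : ℕ) = j)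
    (gcount G σ) (gcount_zero G σ) (gcount_succ G hG σ hp) ℓ
  rw [gcount_top, ← Fin.sum_univ_eq_sum_range, ← Fin.sum_univ_eq_sum_range] at this
  rw [this]
  ring

theorem EE_last {n : ℕ} (hn : 0 < n) (G : SimpleGraph (Fin (n + 1))) (hG : IsNUIG G) :
    EE G (Fin.last n) = - ∑ u ∈ univ.filter (fun u : Fin n => G.Adj u.castSucc (Fin.last n)),
      EE (G.comap Fin.castSucc) u := by
  rw [EE, insertion (fun ℓ κ => if (κ (Fin.last n) : ℕ) = 0 then wt G κ else 0)]
  simp only [EE]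
  rw [Finset.sum_comm, ← Finset.sum_neg_distrib]
  apply Finset.sum_congr rfl
  intro ℓ _
  rw [← Finset.mul_sum, ← mul_neg, Finset.sum_comm, ← Finset.sum_neg_distrib]
  congr 1
  apply Finset.sum_congr rfl
  intro σ _
  by_cases hs : Function.Surjective σ
  swap
  · simp [hs]
  simp only [hs, if_true, sn_last]
  have hℓ : 0 < ℓ := lt_of_le_of_lt (Nat.zero_le _) (σ ⟨0, hn⟩).2
  obtain ⟨m, rfl⟩ : ∃ m, ℓ = m + 1 := ⟨ℓ - 1, by omega⟩
  rw [Fin.sum_univ_succ (n := m), Fin.sum_univ_succ (n := m + 1)]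
  simp only [Fin.val_zero, Fin.val_succ, if_true, Nat.add_eq_zero_iff, one_ne_zero, and_false,
    if_false, Finset.sum_const_zero, add_zero]
  rw [wt_sn, wt_sn_succAbove]
  by_cases hp : IsProper (G.comap Fin.castSucc) σ
  swap
  · simp [wt, hp]
  have h1 := gcount_succ G hG σ hp 0
  have h2 : ∑ u ∈ univ.filter (fun u : Fin n => G.Adj u.castSucc (Fin.last n)),
      (if (σ u : ℕ) = 0 then wt (G.comap Fin.castSucc) σ else 0) =
      (gcount G σ 1 : Polynomial ℤ) * wt (G.comap Fin.castSucc) σ := by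
    rw [← Finset.sum_filter, Finset.sum_const, Finset.filter_filter, nsmul_eq_mul]
    simp [gcount]
  rw [h2, h1]
  simp only [Fin.val_zero, gcount_zero, zero_add, pow_zero, mul_one]
  split_ifs <;> simp

theorem sum_upper {n : ℕ} (B : Fin n → Prop) (hB : ∀ u u', u < u' → B u → B u') :
    ∑ u ∈ univ.filter B, (Polynomial.X : Polynomial ℤ) ^ (n - 1 - (u : ℕ)) =
      qInt (univ.filter B).card := by
  have himg : (univ.filter B).image (fun u : Fin n => n - 1 - (u : ℕ)) =
      range (univ.filter B).card := by
    have hinj : Set.InjOn (fun u : Fin n => n - 1 - (u : ℕ)) (univ.filter B : Finset (Fin n)) := by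
      intro a _ b _ hab
      have := a.2; have := b.2
      apply Fin.ext
      simp only at hab
      omega
    apply Finset.eq_of_subset_of_card_le
    · intro x hx
      obtain ⟨u, hu, rfl⟩ := Finset.mem_image.1 hx
      simp only [Finset.mem_filter, Finset.mem_univ, true_and] at hu
      rw [Finset.mem_range]
      have hsub : Finset.Ici u ⊆ univ.filter B := by
        intro u' hu'
        simp only [Finset.mem_filter, Finset.mem_univ, true_and]
        rcases (Finset.mem_Ici.1 hu').eq_or_lt with h | h
        · exact h ▸ hu
        · exact hB u u' h hu
      have := Finset.card_le_card hsub
      rw [Fin.card_Ici] at this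
      have := u.2
      omega
    · rw [Finset.card_image_of_injOn hinj]; simp
  rw [qInt, ← himg, Finset.sum_image]
  intro a _ b _ hab
  have := a.2; have := b.2
  apply Fin.ext
  simp only at hab
  omega

theorem prod_step {n : ℕ} (hn : 0 < n) (G : SimpleGraph (Fin (n + 1))) :
    ∏ k ∈ univ.filter (fun k : Fin (n + 1) => 1 ≤ (k : ℕ)), qInt (smallerNbrs G k) =
      (∏ k ∈ univ.filter (fun k : Fin n => 1 ≤ (k : ℕ)),
        qInt (smallerNbrs (G.comap Fin.castSucc) k)) * qInt (smallerNbrs G (Fin.last n)) := by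
  rw [Finset.prod_filter, Finset.prod_filter, Fin.prod_univ_castSucc]
  have : 1 ≤ n := hn
  simp [smallerNbrs_castSucc, this]

theorem EE_eq {n : ℕ} (G : SimpleGraph (Fin n)) (hG : IsNUIG G) (v : Fin n) :
    EE G v = (-1) ^ n * Polynomial.X ^ (n - 1 - (v : ℕ)) *
      ∏ k ∈ univ.filter (fun k : Fin n => 1 ≤ (k : ℕ)), qInt (smallerNbrs G k) := by
  induction n with
  | zero => exact v.elim0
  | succ n ih =>
    rcases Nat.eq_zero_or_pos n with rfl | hn
    · have hv : v = 0 := Subsingleton.elim (α := Fin 1) _ _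
      subst hv
      have h1 : ∀ κ : Fin 1 → Fin 1, Function.Surjective κ :=
        fun κ j => ⟨0, Subsingleton.elim _ _⟩
      have h2 : ∀ κ : Fin 1 → Fin 1, wt G κ = 1 := by
        intro κ
        have hp : IsProper G κ := by
          intro i j hij
          rw [Subsingleton.elim (α := Fin 1) i j] at hij
          exact absurd hij (G.loopless.irrefl _)
        have ha : ascNum G κ = 0 := by
          simp [ascNum]
        simp [wt, hp, ha]
      simp [EE, Finset.sum_range_succ, h1, h2]
    · have hG' : IsNUIG (G.comap Fin.castSucc) := fun i j k hij hjk hik =>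
        hG i.castSucc j.castSucc k.castSucc hij hjk hik
      rw [prod_step hn]
      induction v using Fin.lastCases with
      | last =>
        rw [EE_last hn G hG, Finset.sum_congr rfl (fun u _ => ih _ hG' u), ← Finset.sum_mul,
          ← Finset.mul_sum, sum_upper, smallerNbrs_last]
        · simp only [Fin.val_last, Nat.add_sub_cancel, Nat.sub_self, pow_zero, pow_succ]
          ring
        · intro u u' huu hu
          exact (hG u.castSucc u'.castSucc (Fin.last n) huu (Fin.castSucc_lt_last _) hu).2
      | cast w =>
        rw [EE_castSucc G hG, ih _ hG' w]
        have : n + 1 - 1 - ((w.castSucc : Fin (n + 1)) : ℕ) = (n - 1 - (w : ℕ)) + 1 := by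
          have := w.2
          simp only [Fin.val_castSucc]
          omega
        rw [this, pow_succ, pow_succ]
        ring

theorem sum_EE {n : ℕ} (G : SimpleGraph (Fin n)) (hG : IsNUIG G) :
    ∑ v, EE G v = (-1) ^ n * (qInt n *
      ∏ k ∈ univ.filter (fun k : Fin n => 1 ≤ (k : ℕ)), qInt (smallerNbrs G k)) := by
  rw [Finset.sum_congr rfl (fun v _ => EE_eq G hG v), ← Finset.sum_mul, ← Finset.mul_sum]
  have := sum_upper (n := n) (fun _ => True) (fun _ _ _ h => h)
  simp at this
  rw [this]
  ring

/-! ### Extraction of the coefficient -/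

/-- Sum over surjective colourings with `ℓ` colours in which `v` has the smallest colour. -/
noncomputable def ss {n : ℕ} (G : SimpleGraph (Fin n)) (v : Fin n) (ℓ : ℕ) : Polynomial ℤ :=
  ∑ κ : Fin n → Fin ℓ,
    if Function.Surjective κ then (if (κ v : ℕ) = 0 then wt G κ else 0) else 0

theorem EE_ss {n : ℕ} (G : SimpleGraph (Fin n)) (v : Fin n) :
    EE G v = - ∑ ℓ ∈ range n, (-1) ^ ℓ * ss G v (ℓ + 1) := by
  have h0 : ss G v 0 = 0 := by
    apply Finset.sum_eq_zero
    intro κ _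
    exact (κ v).elim0
  change ∑ ℓ ∈ range (n + 1), (-1) ^ ℓ * ss G v ℓ = _
  rw [Finset.sum_range_succ', h0, mul_zero, add_zero, ← Finset.sum_neg_distrib]
  apply Finset.sum_congr rfl
  intro ℓ _
  ring

theorem sum_image_eq {n m : ℕ} (G : SimpleGraph (Fin n)) (v : Fin n) (S : Finset (Fin (m + 1)))
    (h0 : 0 ∈ S) (ℓ : ℕ) (hS : S.card = ℓ) :
    (∑ κ ∈ univ.filter (fun κ : Fin n → Fin (m + 1) => univ.image κ = S),
      if (κ v : ℕ) = 0 then wt G κ else 0) = ss G v ℓ := by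
  rw [ss, ← Finset.sum_filter (fun κ : Fin n → Fin ℓ => Function.Surjective κ)]
  symm
  have hmono : StrictMono (S.orderEmbOfFin hS) := (S.orderEmbOfFin hS).strictMono
  apply Finset.sum_bij (fun (σ : Fin n → Fin ℓ) _ => S.orderEmbOfFin hS ∘ σ)
  · intro σ hσ
    simp only [Finset.mem_filter, Finset.mem_univ, true_and] at hσ ⊢
    rw [← Finset.coe_inj, Finset.coe_image, Finset.coe_univ, Set.image_univ,
      hσ.range_comp, Finset.range_orderEmbOfFin]
  · intro a _ b _ hab
    funext u
    exact hmono.injective (congrFun hab u)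
  · intro κ hκ
    simp only [Finset.mem_filter, Finset.mem_univ, true_and] at hκ
    have hr : Set.range (S.orderEmbOfFin hS) = S := Finset.range_orderEmbOfFin S hS
    have hmem : ∀ u, κ u ∈ Set.range (S.orderEmbOfFin hS) := by
      intro u
      rw [hr, ← hκ]
      simp
    choose σ hσ using hmem
    refine ⟨σ, ?_, funext hσ⟩
    simp only [Finset.mem_filter, Finset.mem_univ, true_and]
    intro j
    have : S.orderEmbOfFin hS j ∈ univ.image κ := by
      rw [hκ]; exact Finset.orderEmbOfFin_mem S hS j
    obtain ⟨u, _, hu⟩ := Finset.mem_image.1 this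
    refine ⟨u, ?_⟩
    rw [← hσ u] at hu
    exact hmono.injective hu
  · intro σ _
    rw [wt_comp G σ _ hmono]
    have hz : ((S.orderEmbOfFin hS (σ v) : Fin (m + 1)) : ℕ) = 0 ↔ (σ v : ℕ) = 0 := by
      have hpos : 0 < ℓ := lt_of_le_of_lt (Nat.zero_le _) (σ v).2
      have hmin : S.orderEmbOfFin hS ⟨0, hpos⟩ = 0 := by
        have h1 : (0 : Fin (m + 1)) ∈ Set.range (S.orderEmbOfFin hS) := by
          rw [Finset.range_orderEmbOfFin]; exact h0
        obtain ⟨j, hj⟩ := h1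
        apply le_antisymm _ (Fin.zero_le _)
        rw [← hj]
        exact hmono.monotone (Nat.zero_le _)
      constructor
      · intro h
        have : S.orderEmbOfFin hS (σ v) = S.orderEmbOfFin hS ⟨0, hpos⟩ := by
          rw [hmin]; exact Fin.ext h
        exact congrArg Fin.val (hmono.injective this)
      · intro h
        have : σ v = ⟨0, hpos⟩ := Fin.ext h
        rw [this, hmin]; rfl
    simp only [Function.comp, hz]

theorem sum_min_colour {n m : ℕ} (G : SimpleGraph (Fin n)) (v : Fin n) :
    (∑ κ : Fin n → Fin (m + 1), if (κ v : ℕ) = 0 then wt G κ else 0) =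
      ∑ ℓ ∈ range (m + 1), (m.choose ℓ : Polynomial ℤ) * ss G v (ℓ + 1) := by
  rw [← Finset.sum_fiberwise (s := univ) (g := fun κ : Fin n → Fin (m + 1) => univ.image κ)]
  have h1 : ∀ S : Finset (Fin (m + 1)),
      (∑ κ ∈ univ.filter (fun κ : Fin n → Fin (m + 1) => univ.image κ = S),
      if (κ v : ℕ) = 0 then wt G κ else 0) = if 0 ∈ S then ss G v S.card else 0 := by
    intro S
    split_ifs with h
    · exact sum_image_eq G v S h _ rfl
    · apply Finset.sum_eq_zero
      intro κ hκ
      simp only [Finset.mem_filter, Finset.mem_univ, true_and] at hκ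
      rw [if_neg]
      intro hv
      apply h
      rw [← hκ, Finset.mem_image]
      exact ⟨v, Finset.mem_univ _, Fin.ext hv⟩
  rw [Finset.sum_congr rfl (fun S _ => h1 S), ← Finset.powerset_univ,
    ← Finset.insert_erase (Finset.mem_univ (0 : Fin (m + 1))),
    Finset.sum_powerset_insert (Finset.notMem_erase _ _)]
  have h2 : ∀ t ∈ (univ.erase (0 : Fin (m + 1))).powerset, (0 : Fin (m + 1)) ∉ t := by
    intro t ht h
    exact Finset.notMem_erase _ _ (Finset.mem_powerset.1 ht h)
  rw [Finset.sum_eq_zero (fun t ht => if_neg (h2 t ht)), zero_add,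
    Finset.sum_congr rfl (g := fun t => ss G v (t.card + 1))]
  · rw [Finset.sum_powerset_apply_card (fun k => ss G v (k + 1))]
    simp
  · intro t ht
    rw [if_pos (Finset.mem_insert_self _ _), Finset.card_insert_of_notMem (h2 t ht)]

theorem one_add_eps_pow (m : ℕ) : (1 + DualNumber.eps : DualNumber (Polynomial ℤ)) ^ m =
    1 + (m : DualNumber (Polynomial ℤ)) * DualNumber.eps := by
  induction m with
  | zero => simp
  | succ m ih =>
    have he : (DualNumber.eps : DualNumber (Polynomial ℤ)) * DualNumber.eps = 0 :=
      DualNumber.eps_mul_eps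
    rw [pow_succ, ih]
    push_cast
    linear_combination (m : DualNumber (Polynomial ℤ)) * he

theorem prod_evp {n N M : ℕ} (κ : Fin n → Fin N) :
    ∏ i, evp N M (κ i) = if ∀ i, (κ i : ℕ) ≤ M then
      (1 + ((univ.filter fun i => (κ i : ℕ) = 0).card : DualNumber (Polynomial ℤ)) *
        DualNumber.eps) else 0 := by
  split_ifs with h
  · rw [← one_add_eps_pow, ← Finset.prod_const, Finset.prod_filter]
    apply Finset.prod_congr rfl
    intro i _
    simp [evp, h i]
  · push Not at h
    obtain ⟨i, hi⟩ := h
    apply Finset.prod_eq_zero (Finset.mem_univ i)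
    rw [evp, if_neg (by omega), if_neg (by omega)]

theorem snd_int (a b : ℤ) : TrivSqZeroExt.snd
    ((a : DualNumber (Polynomial ℤ)) + (b : DualNumber (Polynomial ℤ)) * DualNumber.eps) =
      (b : Polynomial ℤ) := by
  simp [TrivSqZeroExt.snd_mul]

theorem snd_aeval_C_mul {N M : ℕ} (a : Polynomial ℤ) (f : MvPolynomial (Fin N) (Polynomial ℤ)) :
    TrivSqZeroExt.snd (aeval (evp N M) (C a * f)) =
      a * TrivSqZeroExt.snd (aeval (evp N M) f) := by
  rw [map_mul, aeval_C, TrivSqZeroExt.algebraMap_eq_inl]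
  simp

theorem snd_chrom {n N M : ℕ} (h : M + 1 ≤ N) (G : SimpleGraph (Fin n)) :
    TrivSqZeroExt.snd (aeval (evp N M) (chromQSym n N G)) =
      ∑ v, ∑ κ : Fin n → Fin (M + 1), if (κ v : ℕ) = 0 then wt G κ else 0 := by
  have h1 : TrivSqZeroExt.snd (aeval (evp N M) (chromQSym n N G)) =
      ∑ κ ∈ univ.filter (fun κ : Fin n → Fin N => ∀ i, (κ i : ℕ) ≤ M),
        ∑ v, if (κ v : ℕ) = 0 then wt G κ else 0 := by
    rw [chromQSym, map_sum, TrivSqZeroExt.snd_sum, Finset.sum_filter]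
    apply Finset.sum_congr rfl
    intro κ _
    by_cases hp : IsProper G κ
    · rw [if_pos hp, snd_aeval_C_mul, map_prod]
      simp only [aeval_X, prod_evp]
      split_ifs with hM
      · rw [← Finset.sum_filter, Finset.sum_const, nsmul_eq_mul, wt, if_pos hp]
        have := snd_int 1 (univ.filter fun i => (κ i : ℕ) = 0).card
        push_cast at this
        rw [this]
        ring
      · simp
    · simp [hp, wt]
  rw [h1, Finset.sum_comm]
  apply Finset.sum_congr rfl
  intro v _
  symm
  have hmono : StrictMono (Fin.castLE h) := Fin.strictMono_castLE h
  apply Finset.sum_bij (fun (κ : Fin n → Fin (M + 1)) _ => Fin.castLE h ∘ κ)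
  · intro κ _
    simp only [Finset.mem_filter, Finset.mem_univ, true_and, Function.comp, Fin.val_castLE]
    intro i
    have := (κ i).2
    omega
  · intro a _ b _ hab
    funext u
    exact hmono.injective (congrFun hab u)
  · intro κ hκ
    simp only [Finset.mem_filter, Finset.mem_univ, true_and] at hκ
    exact ⟨fun i => ⟨κ i, by have := hκ i; omega⟩, Finset.mem_univ _, rfl⟩
  · intro κ _
    rw [wt_comp G κ _ hmono]
    simp

theorem choose_sum_int {n ℓ : ℕ} (h : ℓ < n) :
    ∑ M ∈ range n, (-1 : ℤ) ^ M * (n.choose (M + 1) : ℤ) * (M.choose ℓ : ℤ) = (-1) ^ ℓ := by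
  obtain ⟨P, h1, h2, h3⟩ := exists_binPoly ℓ
  have := sum_eval_neg_one (n := n) P (lt_of_le_of_lt h1 (by exact_mod_cast h))
  simp only [h2, h3] at this
  exact_mod_cast this

theorem lhs_functional {n N : ℕ} (hN : n ≤ N) (G : SimpleGraph (Fin n)) :
    ∑ M ∈ range n, (-1 : Polynomial ℤ) ^ M * (n.choose (M + 1) : Polynomial ℤ) *
      TrivSqZeroExt.snd (aeval (evp N M) (chromQSym n N G)) = - ∑ v, EE G v := by
  have h1 : ∀ M ∈ range n, (-1 : Polynomial ℤ) ^ M * (n.choose (M + 1) : Polynomial ℤ) *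
      TrivSqZeroExt.snd (aeval (evp N M) (chromQSym n N G)) =
      ∑ v, ∑ ℓ ∈ range n, (-1 : Polynomial ℤ) ^ M * (n.choose (M + 1) : Polynomial ℤ) *
        (M.choose ℓ : Polynomial ℤ) * ss G v (ℓ + 1) := by
    intro M hM
    have hM' : M < n := by simpa using hM
    rw [snd_chrom (by omega), Finset.mul_sum]
    apply Finset.sum_congr rfl
    intro v _
    rw [sum_min_colour, Finset.mul_sum]
    simp only [← mul_assoc]
    apply Finset.sum_subset
    · intro x; simp only [Finset.mem_range]; omega
    · intro x _ hx
      simp only [Finset.mem_range] at hx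
      rw [Nat.choose_eq_zero_of_lt (show M < x by omega)]
      simp
  rw [Finset.sum_congr rfl h1, Finset.sum_comm, ← Finset.sum_neg_distrib]
  apply Finset.sum_congr rfl
  intro v _
  rw [EE_ss, neg_neg, Finset.sum_comm]
  apply Finset.sum_congr rfl
  intro ℓ hℓ
  rw [← Finset.sum_mul]
  congr 1
  have := congrArg (Int.cast : ℤ → Polynomial ℤ) (choose_sum_int (Finset.mem_range.1 hℓ))
  push_cast at this
  exact this

theorem rhs_functional {n N : ℕ} (hN : n ≤ N) (p : Nat.Partition n) :
    ∑ M ∈ range n, (-1 : Polynomial ℤ) ^ M * (n.choose (M + 1) : Polynomial ℤ) *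
      TrivSqZeroExt.snd (aeval (evp N M) (eProd N (Polynomial ℤ) p)) =
      if Multiset.card p.parts = 1 then (-1) ^ (n - 1) else 0 := by
  obtain ⟨E, D, d0, d1, -, hD, -, hD', hev, -, hD1⟩ :=
    exists_poly_prod p.parts (fun k hk => p.parts_pos hk)
  rw [p.parts_sum] at hD hD1
  have h1 := sum_eval_neg_one D hD
  rw [hD1] at h1
  simp only [hD'] at h1
  have h2 : ∑ M ∈ range n, (-1 : ℤ) ^ M * (n.choose (M + 1) : ℤ) * d1 M =
      if Multiset.card p.parts = 1 then (-1) ^ (n - 1) else 0 := by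
    exact_mod_cast h1
  have h3 := congrArg (Int.cast : ℤ → Polynomial ℤ) h2
  push_cast at h3
  rw [← h3]
  apply Finset.sum_congr rfl
  intro M hM
  have hM' : M < n := by simpa using hM
  rw [eProd, hev N M (by omega), snd_int]

/-- for a natural unit interval graph the coefficient of `e_n`
in `X_G(x;q)` equals `[n]_q [b_2]_q ⋯ [b_n]_q`. -/
theorem stmt15 (n N : ℕ) (hN : n ≤ N) (G : SimpleGraph (Fin n)) (hG : IsNUIG G)
    (c : Nat.Partition n → Polynomial ℤ)
    (hc : chromQSym n N G = ∑ p : Nat.Partition n, C (c p) * eProd N (Polynomial ℤ) p)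
    (p : Nat.Partition n) (hp : p.parts = {n}) :
    c p = qInt n * ∏ k ∈ Finset.univ.filter (fun k : Fin n => 1 ≤ (k : ℕ)),
      qInt (smallerNbrs G k) := by
  have hn : 0 < n := p.parts_pos (by rw [hp]; simp)
  have h1 := lhs_functional hN G
  rw [hc, sum_EE G hG] at h1
  simp only [map_sum, TrivSqZeroExt.snd_sum, snd_aeval_C_mul, Finset.mul_sum] at h1
  rw [Finset.sum_comm] at h1
  have h2 : ∀ r : Nat.Partition n, (∑ M ∈ range n, (-1 : Polynomial ℤ) ^ M *
      (n.choose (M + 1) : Polynomial ℤ) *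
      (c r * TrivSqZeroExt.snd (aeval (evp N M) (eProd N (Polynomial ℤ) r)))) =
      if r = p then c p * (-1) ^ (n - 1) else 0 := by
    intro r
    have hr : Multiset.card r.parts = 1 ↔ r = p := by
      constructor
      · intro h
        obtain ⟨a, ha⟩ := Multiset.card_eq_one.1 h
        have hs := r.parts_sum
        rw [ha, Multiset.sum_singleton] at hs
        apply Nat.Partition.ext
        rw [ha, hp, hs]
      · rintro rfl
        rw [hp]; simp
    have h3 := rhs_functional hN r
    calc _ = c r * ∑ M ∈ range n, (-1 : Polynomial ℤ) ^ M * (n.choose (M + 1) : Polynomial ℤ) *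
      TrivSqZeroExt.snd (aeval (evp N M) (eProd N (Polynomial ℤ) r)) := by
          rw [Finset.mul_sum]
          apply Finset.sum_congr rfl
          intro M _
          ring
      _ = _ := by
          rw [h3]
          simp only [hr]
          split_ifs with h
          · rw [h]
          · simp
  rw [Finset.sum_congr rfl (fun r _ => h2 r), Finset.sum_ite_eq' univ p] at h1
  simp only [Finset.mem_univ, if_true] at h1
  obtain ⟨m, rfl⟩ : ∃ m, n = m + 1 := ⟨n - 1, by omega⟩
  rw [Nat.add_sub_cancel, pow_succ] at h1
  have hu : ((-1 : Polynomial ℤ) ^ m) * (-1) ^ m = 1 := by rw [← mul_pow]; simp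
  have h4 := congrArg (fun x => x * (-1 : Polynomial ℤ) ^ m) h1
  rw [mul_assoc, hu, mul_one] at h4
  rw [h4]
  linear_combination (qInt (m + 1) * ∏ k ∈ Finset.univ.filter (fun k : Fin (m + 1) => 1 ≤ (k : ℕ)),
      qInt (smallerNbrs G k)) * hu
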